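/- Let s, t be integers with L ≥ s > t ≥ 0 and (s,t) ≠ (L,0), and let Φ_{pq} ∈ ℝ for 1 ≤ p ≤ n_s, 1 ≤ q ≤ n_t. If Σ_{p=1}^{n_s} Σ_{q=1}^{n_t} Φ_{pq} · 𝐖^(s,t)_{pq} = 0 in R, then Φ_{pq} = 0 for all p, q. -/

import Mathlib

open Matrix MvPolynomial

noncomputable section

/-- Indeterminates: `Sum.inl (i, j, k)` is `x^(i)_{jk}` and `Sum.inr (i, j)` is `y^(i)_j`. -/
abbrev PVar : Type := (ℕ × ℕ × ℕ) ⊕ (ℕ × ℕ)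

/-- The polynomial ring `R` with real coefficients in the indeterminates
`x^(i)_{jk}` and `y^(i)_j`. -/
abbrev Rpoly : Type := MvPolynomial PVar ℝ

/-- The matrix `𝐖^(i)` of indeterminates, with `(j,k)` entry `x^(i)_{jk}`. -/
def Wm (n : ℕ → ℕ) (i : ℕ) : Matrix (Fin (n i)) (Fin (n (i - 1))) Rpoly :=
  Matrix.of fun j k => MvPolynomial.X (Sum.inl (i, (j : ℕ), (k : ℕ)))

/-- The column vector `𝐛^(i)` of indeterminates, with `j`-th entry `y^(i)_j`. -/
def bm (n : ℕ → ℕ) (i : ℕ) : Matrix (Fin (n i)) (Fin 1) Rpoly :=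
  Matrix.of fun j _ => MvPolynomial.X (Sum.inr (i, (j : ℕ)))

/-- The product `𝐖^(s,t) = 𝐖^(s) * 𝐖^(s-1) * ⋯ * 𝐖^(t+1)` of `s - t` matrices. -/
def WmProd (n : ℕ → ℕ) : (s : ℕ) → (t : ℕ) → Matrix (Fin (n s)) (Fin (n t)) Rpoly
  | s, t =>
    if _h : t < s then Wm n s * WmProd n (s - 1) t
    else Matrix.of fun i j => if (i : ℕ) = (j : ℕ) then (1 : Rpoly) else 0
termination_by s t => s
decreasing_by omega

/-- The entrywise inclusion of a real matrix into matrices over `R`. -/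
def toR {m k : Type*} (M : Matrix m k ℝ) : Matrix m k Rpoly :=
  M.map (MvPolynomial.C)

theorem WmProd_self (n : ℕ → ℕ) (t : ℕ) : WmProd n t t = 1 := by
  rw [WmProd, dif_neg (lt_irrefl t)]
  ext i j
  simp [Matrix.one_apply, Fin.ext_iff]

theorem WmProd_succ_apply (n : ℕ → ℕ) {s t : ℕ} (h : t ≤ s) (p : Fin (n (s + 1)))
    (q : Fin (n t)) :
    WmProd n (s + 1) t p q = ∑ k : Fin (n s), Wm n (s + 1) p k * WmProd n s t k q := by
  rw [WmProd, dif_pos (Nat.lt_succ_of_le h)]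
  rfl

/-- The point at which `x^(i)_{jk}` is `1` if the path `c` passes through `k` at level `i - 1`
and through `j` at level `i`, and every other indeterminate is `0`. -/
def pathPoint (c : ℕ → ℕ) : PVar → ℝ
  | Sum.inl (i, j, k) => if j = c i ∧ k = c (i - 1) then 1 else 0
  | Sum.inr _ => 0

theorem eval_pathPoint_Wm (n c : ℕ → ℕ) (i : ℕ) (p : Fin (n (i + 1))) (q : Fin (n i)) :
    MvPolynomial.eval (pathPoint c) (Wm n (i + 1) p q) =
      if (p : ℕ) = c (i + 1) ∧ (q : ℕ) = c i then 1 else 0 := by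
  simp [Wm, pathPoint]

theorem eval_pathPoint_WmProd (n c : ℕ → ℕ) (hc : ∀ i, c i < n i) {s t : ℕ} (hts : t < s)
    (p : Fin (n s)) (q : Fin (n t)) :
    MvPolynomial.eval (pathPoint c) (WmProd n s t p q) =
      if (p : ℕ) = c s ∧ (q : ℕ) = c t then 1 else 0 := by
  induction s, hts using Nat.le_induction with
  | base =>
    rw [WmProd_succ_apply n le_rfl, WmProd_self]
    simpa [Matrix.one_apply] using eval_pathPoint_Wm n c t p q
  | succ s hs ih =>
    rw [WmProd_succ_apply n (by omega), map_sum,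
      Finset.sum_eq_single (⟨c s, hc s⟩ : Fin (n s))]
    · rw [map_mul, eval_pathPoint_Wm, ih]
      simp [← ite_and, and_comm]
    · intro b _ hb
      have hb' : (b : ℕ) ≠ c s := fun h => hb (Fin.ext h)
      rw [map_mul, ih]
      simp [hb']
    · simp

/-- Lemma: linear independence of the entries of `𝐖^(s,t)` for `(s,t) ≠ (L,0)`. -/
theorem phi_eq_zero_of_W_combination (L : ℕ) (hL : 1 ≤ L) (n : ℕ → ℕ) (hn : ∀ i, 1 ≤ n i)
    (s t : ℕ) (hts : t < s) (hsL : s ≤ L) (hne : ¬(s = L ∧ t = 0))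
    (Φ : Fin (n s) → Fin (n t) → ℝ)
    (h : (∑ p, ∑ q, MvPolynomial.C (Φ p q) * (WmProd n s t) p q) = (0 : Rpoly)) :
    ∀ p q, Φ p q = 0 := by
  intro p q
  let c : ℕ → ℕ := fun i => if i = s then p else if i = t then q else 0
  have hcs : c s = p := by simp [c]
  have hct : c t = q := by simp [c, hts.ne]
  have hc : ∀ i, c i < n i := by
    intro i
    by_cases his : i = s
    · subst his
      simp [hcs]
    by_cases hit : i = t
    · subst hit
      simp [hct]
    · simpa [c, his, hit] using Nat.succ_le_iff.mp (hn i)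
  have key := congrArg (MvPolynomial.eval (pathPoint c)) h
  simpa [eval_pathPoint_WmProd n c hc hts, hcs, hct, ← Fin.ext_iff, ite_and] using key
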